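/- arXiv:1201.5317 — 2 statements merged into one kernel-verified Lean document; each statement's English description precedes it below -/
import Mathlib

section
/- Let (Γ,G) be a locally-Z2^[3] pair that is degenerate, i.e., there exist vertices u,v with {u,u'} ≠ {v,v'} such that at least two distinct edges of Γ have one endpoint in {u,u'} and the other endpoint in {v,v'}. Then Γ is isomorphic either to a circular ladder graph Cay(Z/n × Z/2, {(1,0),(-1,0),(0,1)}) for some n ≥ 3, or to a Möbius ladder graph Cay(Z/2n, {1,-1,n}) for some n ≥ 2. -/
/-- The Cayley graph of an additive group `K` with connection set `S`: vertices are the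
elements of `K`, with `u` adjacent to `v` iff `u - v ∈ S`. (For an inverse-closed and
identity-free `S` this coincides with `SimpleGraph.fromRel (fun u v => u - v ∈ S)`.) -/
def addCayleyGraph (K : Type*) [AddGroup K] (S : Set K) : SimpleGraph K :=
  SimpleGraph.fromRel (fun u v => u - v ∈ S)

/-- The circular ladder graph of order `2n`, i.e. `Cay(Z/n × Z/2, {(1,0),(-1,0),(0,1)})`. -/
def circularLadder (n : ℕ) : SimpleGraph (ZMod n × ZMod 2) :=
  addCayleyGraph (ZMod n × ZMod 2) {((1 : ZMod n), (0 : ZMod 2)), (-1, 0), (0, 1)}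

/-- The Möbius ladder graph of order `2n`, i.e. `Cay(Z/2n, {1,-1,n})`. -/
def mobiusLadder (n : ℕ) : SimpleGraph (ZMod (2 * n)) :=
  addCayleyGraph (ZMod (2 * n)) {(1 : ZMod (2 * n)), -1, (n : ZMod (2 * n))}

variable {V : Type*}

/-- The set of orbits of the vertex-stabiliser `G_v` on the neighbourhood `Γ(v)`. -/
def nbhdOrbits (Γ : SimpleGraph V) (G : Subgroup (Γ ≃g Γ)) (v : V) : Set (Set V) :=
  {O | ∃ u ∈ Γ.neighborSet v, O = {w | ∃ g ∈ G, g v = v ∧ g u = w}}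

/-- A bi-infinite walk in a cubic graph with a matching `f` that uses no matching edge and never
backtracks. -/
structure IsRail (Γ : SimpleGraph V) (f : V → V) (w : ℤ → V) : Prop where
  ne : ∀ k, w (k - 1) ≠ w (k + 1)
  prev_ne : ∀ k, w (k - 1) ≠ f (w k)
  next_ne : ∀ k, w (k + 1) ≠ f (w k)
  adj_iff : ∀ k u, Γ.Adj (w k) u ↔ u = f (w k) ∨ u = w (k - 1) ∨ u = w (k + 1)

namespace IsRail

variable {Γ : SimpleGraph V} {f : V → V} {a b w : ℤ → V}

theorem shift (h : IsRail Γ f w) (m : ℤ) : IsRail Γ f (fun k => w (k + m)) where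
  ne k := by simpa only [sub_add_eq_add_sub, add_right_comm] using h.ne (k + m)
  prev_ne k := by simpa only [sub_add_eq_add_sub, add_right_comm] using h.prev_ne (k + m)
  next_ne k := by simpa only [sub_add_eq_add_sub, add_right_comm] using h.next_ne (k + m)
  adj_iff k u := by
    simpa only [sub_add_eq_add_sub, add_right_comm] using h.adj_iff (k + m) u

theorem reflect (h : IsRail Γ f w) : IsRail Γ f (fun k => w (-k)) := by
  have e₁ : ∀ k : ℤ, -(k - 1) = -k + 1 := fun k => by ring
  have e₂ : ∀ k : ℤ, -(k + 1) = -k - 1 := fun k => by ring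
  constructor <;> intro k <;> simp only [e₁, e₂]
  · exact (h.ne (-k)).symm
  · exact h.next_ne (-k)
  · exact h.prev_ne (-k)
  · intro u
    rw [h.adj_iff (-k) u]
    tauto

theorem comp (h : IsRail Γ f w) (ff : ∀ v, f (f v) = v)
    (haut : ∀ x y, Γ.Adj x y → Γ.Adj (f x) (f y)) : IsRail Γ f (fun k => f (w k)) := by
  have hinj : Function.Injective f := Function.LeftInverse.injective ff
  refine ⟨fun k e => h.ne k (hinj e), fun k e => h.prev_ne k (hinj e),
    fun k e => h.next_ne k (hinj e), fun k u => ?_⟩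
  have : Γ.Adj (f (w k)) u ↔ Γ.Adj (w k) (f u) :=
    ⟨fun e => by simpa [ff] using haut _ _ e, fun e => by simpa [ff] using haut _ _ e⟩
  rw [this, h.adj_iff]
  have e : ∀ x y, f x = y ↔ x = f y :=
    fun x y => ⟨fun e => by rw [← e, ff], fun e => by rw [e, ff]⟩
  simp only [e]

theorem next_eq (ha : IsRail Γ f a) (hb : IsRail Γ f b) {k : ℤ} (h₀ : a k = b k)
    (h₁ : a (k - 1) = b (k - 1)) : a (k + 1) = b (k + 1) := by
  have h := (ha.adj_iff k (a (k + 1))).2 (by tauto)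
  rw [h₀, hb.adj_iff] at h
  rcases h with h | h | h
  · exact absurd (h₀ ▸ h) (ha.next_ne k)
  · exact absurd (h₁.trans h.symm) (ha.ne k)
  · exact h

theorem prev_eq (ha : IsRail Γ f a) (hb : IsRail Γ f b) {k : ℤ} (h₀ : a k = b k)
    (h₁ : a (k + 1) = b (k + 1)) : a (k - 1) = b (k - 1) := by
  have h := (ha.adj_iff k (a (k - 1))).2 (by tauto)
  rw [h₀, hb.adj_iff] at h
  rcases h with h | h | h
  · exact absurd (h₀ ▸ h) (ha.prev_ne k)
  · exact h
  · exact absurd (h.trans h₁.symm) (ha.ne k)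

theorem eq_of_eq (ha : IsRail Γ f a) (hb : IsRail Γ f b) (h₀ : a 0 = b 0) (h₁ : a 1 = b 1)
    (k : ℤ) : a k = b k := by
  suffices h : a k = b k ∧ a (k + 1) = b (k + 1) from h.1
  induction k using Int.induction_on with
  | zero => exact ⟨h₀, by simpa using h₁⟩
  | succ i ih => exact ⟨ih.2, ha.next_eq hb ih.2 (by simpa using ih.1)⟩
  | pred i ih => exact ⟨ha.prev_eq hb ih.1 ih.2, by simpa using ih.1⟩

theorem eq_or_eq_neg (ha : IsRail Γ f a) (hb : IsRail Γ f b) (h₀ : a 0 = b 0) :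
    (∀ k, a k = b k) ∨ ∀ k, a k = b (-k) := by
  have h := (ha.adj_iff 0 (a 1)).2 (by simp)
  rw [h₀, hb.adj_iff] at h
  rcases h with h | h | h
  · exact absurd (h₀ ▸ h) (by simpa using ha.next_ne 0)
  · exact .inr (ha.eq_of_eq hb.reflect (by simpa using h₀) (by simpa using h))
  · exact .inl (ha.eq_of_eq hb h₀ (by simpa using h))

theorem adj_succ (h : IsRail Γ f w) (k : ℤ) : Γ.Adj (w k) (w (k + 1)) :=
  (h.adj_iff k _).2 (by tauto)

/-- A rail that returns to a vertex does so in the same direction. -/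
theorem periodic (h : IsRail Γ f w) {i j : ℤ} (hij : w i = w j) (k : ℤ) :
    w (k + i) = w (k + j) := by
  rcases (h.shift i).eq_or_eq_neg (h.shift j) (by simpa using hij) with e | e
  · exact e k
  · exfalso
    obtain ⟨r, hr | hr⟩ := Int.even_or_odd' (i + j)
    · have := e (r + 1 - i)
      rw [show r + 1 - i + i = r + 1 by ring, show -(r + 1 - i) + j = r - 1 by linarith] at this
      exact h.ne r this.symm
    · have := e (r - i)
      rw [show r - i + i = r by ring, show -(r - i) + j = r + 1 by linarith] at this
      exact (h.adj_succ r).ne this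

/-- If the matching maps some vertex of a rail into the rail, it acts on the rail by translation. -/
theorem matching_translate (h : IsRail Γ f w) (ff : ∀ v, f (f v) = v)
    (haut : ∀ x y, Γ.Adj x y → Γ.Adj (f x) (f y)) (hf : ∀ v, Γ.Adj v (f v)) {i j : ℤ}
    (hij : f (w i) = w j) (k : ℤ) : f (w (k + i)) = w (k + j) := by
  rcases ((h.comp ff haut).shift i).eq_or_eq_neg (h.shift j) (by simpa using hij) with e | e
  · exact e k
  · exfalso
    obtain ⟨r, hr | hr⟩ := Int.even_or_odd' (i + j)
    · have := e (r - i)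
      rw [show r - i + i = r by ring, show -(r - i) + j = r by linarith] at this
      exact (hf (w r)).ne this.symm
    · have := e (r - i)
      rw [show r - i + i = r by ring, show -(r - i) + j = r + 1 by linarith] at this
      exact h.next_ne r this.symm

theorem exists_period [Finite V] (h : IsRail Γ f w) :
    ∃ N : ℕ, 3 ≤ N ∧ ∀ i j : ℤ, w i = w j ↔ (i : ZMod N) = j := by
  let P : AddSubgroup ℤ :=
    { carrier := {p | w p = w 0}
      zero_mem' := rfl
      add_mem' := fun {p q} hp hq => by
        have := h.periodic hq p
        rw [add_zero] at this
        exact this.trans hp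
      neg_mem' := fun {p} hp => by
        have := h.periodic hp (-p)
        simpa using this.symm }
  have hP : ∀ i j : ℤ, w i = w j ↔ j - i ∈ P := fun i j => by
    refine ⟨fun e => ?_, fun e => ?_⟩
    · have := h.periodic e (-i)
      rw [neg_add_cancel, neg_add_eq_sub] at this
      exact this.symm
    · have := h.periodic (show w (j - i) = w 0 from e) i
      simpa using this.symm
  obtain ⟨n, hn⟩ := Int.subgroup_cyclic P
  have key : ∀ i j : ℤ, w i = w j ↔ (i : ZMod n.natAbs) = j := fun i j => by
    rw [hP, hn, AddSubgroup.mem_closure_singleton, ZMod.intCast_eq_intCast_iff_dvd_sub,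
      Int.natAbs_dvd, dvd_iff_exists_eq_mul_left]
    simp [eq_comm]
  refine ⟨n.natAbs, ?_, key⟩
  obtain ⟨i, j, hne, hij⟩ := Finite.exists_ne_map_eq_of_infinite w
  rw [key] at hij
  have h₁ := (h.adj_succ 0).ne
  have h₂ := h.ne 1
  norm_num at h₁ h₂
  rw [key] at h₁ h₂
  by_contra! hlt
  generalize n.natAbs = N at *
  interval_cases N
  · exact hne (by simpa using hij)
  · exact h₁ (Subsingleton.elim _ _)
  · exact h₂ (by decide)

theorem mem_range_or [Finite V] (h : IsRail Γ f w) (hconn : Γ.Connected) (ff : ∀ v, f (f v) = v)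
    (haut : ∀ x y, Γ.Adj x y → Γ.Adj (f x) (f y)) (v : V) :
    (∃ k, w k = v) ∨ ∃ k, f (w k) = v := by
  obtain ⟨p⟩ := hconn.preconnected v (w 0)
  generalize hz : w 0 = z at p
  induction p with
  | nil => exact .inl ⟨0, hz⟩
  | cons hadj p ih =>
    rcases ih hz with ⟨k, hk⟩ | ⟨k, hk⟩
    · rw [← hk] at hadj
      rcases (h.adj_iff k _).1 hadj.symm with e | e | e
      · exact .inr ⟨_, e.symm⟩
      · exact .inl ⟨_, e.symm⟩
      · exact .inl ⟨_, e.symm⟩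
    · rw [← hk] at hadj
      rcases ((h.comp ff haut).adj_iff k _).1 hadj.symm with e | e | e
      · exact .inl ⟨k, by rw [e, ff]⟩
      · exact .inr ⟨_, e.symm⟩
      · exact .inr ⟨_, e.symm⟩

end IsRail

theorem exists_isRail [Finite V] [Nonempty V] {Γ : SimpleGraph V} {f : V → V}
    (ff : ∀ v, f (f v) = v)
    (hnb : ∀ v, ∃ a b, a ≠ b ∧ a ≠ f v ∧ b ≠ f v ∧ ∀ u, Γ.Adj v u ↔ u = f v ∨ u = a ∨ u = b) :
    ∃ w, IsRail Γ f w := by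
  let D := {p : V × V // Γ.Adj p.1 p.2 ∧ p.2 ≠ f p.1}
  have flip : ∀ {x y : V}, y ≠ f x → x ≠ f y := fun h e => h (by rw [e, ff])
  have third : ∀ p : D, ∃ z, Γ.Adj p.1.2 z ∧ z ≠ f p.1.2 ∧ z ≠ p.1.1 ∧
      ∀ u, Γ.Adj p.1.2 u ↔ u = f p.1.2 ∨ u = p.1.1 ∨ u = z := by
    rintro ⟨⟨x, y⟩, hxy, hne⟩
    obtain ⟨a, b, hab, ha, hb, hu⟩ := hnb y
    have hx := (hu x).1 hxy.symm
    have := flip hne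
    simp only at *
    rcases hx with hx | rfl | rfl
    · exact absurd hx this
    · exact ⟨b, by rw [hu]; tauto, hb, hab.symm, hu⟩
    · exact ⟨a, by rw [hu]; tauto, ha, hab, fun u => by rw [hu]; tauto⟩
  choose z hz hzf hzx hzu using third
  let s : D → D := fun p => ⟨(p.1.2, z p), hz p, hzf p⟩
  have hs : Function.Injective s := by
    intro p q hpq
    have h₁ : p.1.2 = q.1.2 := congrArg (fun r : D => r.1.1) hpq
    have h₂ : z p = z q := congrArg (fun r : D => r.1.2) hpq
    have h₃ := (hzu q p.1.1).1 (h₁ ▸ p.2.1.symm)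
    refine Subtype.ext (Prod.ext ?_ h₁)
    rcases h₃ with h | h | h
    · exact absurd (h₁ ▸ h) (flip p.2.2)
    · exact h
    · exact absurd (h₂.trans h.symm) (hzx p)
  let σ : Equiv.Perm D := Equiv.ofBijective s (Finite.injective_iff_bijective.1 hs)
  have d : D := by
    let v := Classical.arbitrary V
    have := hnb v
    choose a b _ ha _ hu using this
    exact ⟨(v, a), by simp [hu], ha⟩
  have next : ∀ k : ℤ, (σ ^ (k + 1)) d = s ((σ ^ k) d) := fun k => by
    rw [add_comm, zpow_one_add]
    rfl
  refine ⟨fun k => ((σ ^ k) d).1.1, ?_⟩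
  have local_structure : ∀ k : ℤ, ∃ p : D, ((σ ^ (k - 1)) d).1.1 = p.1.1 ∧
      ((σ ^ k) d).1.1 = p.1.2 ∧ ((σ ^ (k + 1)) d).1.1 = z p := fun k => by
    refine ⟨(σ ^ (k - 1)) d, rfl, ?_, ?_⟩
    · have := next (k - 1)
      rw [sub_add_cancel] at this
      rw [this]
    · have := next (k - 1)
      rw [sub_add_cancel] at this
      rw [next, this]
  constructor <;> intro k <;> obtain ⟨p, h₁, h₂, h₃⟩ := local_structure k <;>
    simp only [h₁, h₂, h₃]
  · exact (hzx p).symm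
  · exact flip p.2.2
  · exact hzf p
  · exact hzu p

theorem addCayleyGraph_adj {K : Type*} [AddGroup K] {S : Set K} {u v : K} :
    (addCayleyGraph K S).Adj u v ↔ u ≠ v ∧ (u - v ∈ S ∨ v - u ∈ S) :=
  Iff.rfl

theorem mobiusLadder_adj {n : ℕ} (hn : 2 ≤ n) {u v : ZMod (2 * n)} :
    (mobiusLadder n).Adj u v ↔ v = u + n ∨ v = u - 1 ∨ v = u + 1 := by
  have hnn : (n : ZMod (2 * n)) + n = 0 := by
    have := ZMod.natCast_self (2 * n)
    push_cast at this
    rw [← two_mul, this]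
  have h₁ : (1 : ZMod (2 * n)) ≠ 0 := by
    have : Fact (1 < 2 * n) := ⟨by omega⟩
    exact one_ne_zero
  have hn₀ : (n : ZMod (2 * n)) ≠ 0 := by
    rw [Ne, ZMod.natCast_eq_zero_iff]
    intro h
    have := Nat.le_of_dvd (by omega) h
    omega
  have hneg : -(n : ZMod (2 * n)) = n := neg_eq_of_add_eq_zero_left hnn
  obtain ⟨t, rfl⟩ : ∃ t, v = u + t := ⟨v - u, by abel⟩
  have hsub : u - (u + t) = -t := by abel
  simp only [mobiusLadder, addCayleyGraph_adj, hsub, add_sub_cancel_left, sub_eq_add_neg u 1,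
    Set.mem_insert_iff, Set.mem_singleton_iff, add_right_inj, neg_eq_iff_eq_neg, hneg,
    left_eq_add, Ne, neg_neg]
  constructor
  · tauto
  · rintro (rfl | rfl | rfl) <;> simp [h₁, hn₀]

theorem circularLadder_adj {n : ℕ} (hn : 3 ≤ n) {u v : ZMod n × ZMod 2} :
    (circularLadder n).Adj u v ↔
      v = u + (0, 1) ∨ v = u + (-1, 0) ∨ v = u + (1, 0) := by
  have h₁ : (1 : ZMod n) ≠ 0 := by
    have : Fact (1 < n) := ⟨by omega⟩
    exact one_ne_zero
  obtain ⟨t, rfl⟩ : ∃ t, v = u + t := ⟨v - u, by abel⟩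
  have hsub : u - (u + t) = -t := by abel
  have h₂ : -(1 : ZMod 2) = 1 := by decide
  simp only [circularLadder, addCayleyGraph_adj, hsub, add_sub_cancel_left,
    Set.mem_insert_iff, Set.mem_singleton_iff, add_right_inj, neg_eq_iff_eq_neg,
    left_eq_add, Ne, Prod.neg_mk, neg_zero, neg_neg, h₂]
  constructor
  · tauto
  · rintro (rfl | rfl | rfl) <;> simp [h₁]

theorem ladder_of_matching_automorphism [Finite V] {Γ : SimpleGraph V} (hconn : Γ.Connected)
    {f : V → V} (ff : ∀ v, f (f v) = v) (hf : ∀ v, Γ.Adj v (f v))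
    (haut : ∀ x y, Γ.Adj x y → Γ.Adj (f x) (f y))
    (hnb : ∀ v, ∃ a b, a ≠ b ∧ a ≠ f v ∧ b ≠ f v ∧ ∀ u, Γ.Adj v u ↔ u = f v ∨ u = a ∨ u = b) :
    (∃ n : ℕ, 3 ≤ n ∧ Nonempty (Γ ≃g circularLadder n)) ∨
    (∃ n : ℕ, 2 ≤ n ∧ Nonempty (Γ ≃g mobiusLadder n)) := by
  have := hconn.nonempty
  obtain ⟨w, hw⟩ := exists_isRail ff hnb
  obtain ⟨N, hN, hper⟩ := hw.exists_period
  have hinj : Function.Injective f := Function.LeftInverse.injective ff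
  have hcover := hw.mem_range_or hconn ff haut
  let E : ZMod N → V := fun x => w (x.cast : ℤ)
  have hE : ∀ k : ℤ, E k = w k := fun k => (hper _ _).2 (ZMod.intCast_zmod_cast _)
  have hEinj : Function.Injective E := fun x y h => by
    have := (hper _ _).1 h
    rwa [ZMod.intCast_zmod_cast, ZMod.intCast_zmod_cast] at this
  have hEadj : ∀ x u, Γ.Adj (E x) u ↔ u = f (E x) ∨ u = E (x - 1) ∨ u = E (x + 1) := by
    intro x u
    obtain ⟨k, rfl⟩ := ZMod.intCast_surjective x
    have e₁ : (k : ZMod N) - 1 = ((k - 1 : ℤ) : ZMod N) := by push_cast; rfl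
    have e₂ : (k : ZMod N) + 1 = ((k + 1 : ℤ) : ZMod N) := by push_cast; rfl
    rw [e₁, e₂, hE, hE, hE, hw.adj_iff]
  by_cases hmeet : ∃ m, f (w 0) = w m
  · right
    obtain ⟨m, hm⟩ := hmeet
    have htr : ∀ k, f (w k) = w (k + m) := fun k => by
      simpa using hw.matching_translate ff haut hf hm k
    have hm₀ : ((m : ℤ) : ZMod N) ≠ 0 := fun e => by
      have : w 0 = w m := (hper _ _).2 (by simpa using e.symm)
      exact (hf (w 0)).ne (this.trans hm.symm)
    have hm₂ : ((m + m : ℤ) : ZMod N) = 0 := by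
      have : w 0 = w (m + m) := by rw [← htr, ← hm, ff]
      simpa using ((hper _ _).1 this).symm
    obtain ⟨n, rfl, hn⟩ : ∃ n : ℕ, N = 2 * n ∧ ((m : ℤ) : ZMod N) = (n : ℕ) := by
      rw [ZMod.intCast_zmod_eq_zero_iff_dvd] at hm₂
      rw [Ne, ZMod.intCast_zmod_eq_zero_iff_dvd] at hm₀
      obtain ⟨c, hc⟩ := hm₂
      obtain ⟨r, hr | hr⟩ := Int.even_or_odd' c
      · exact absurd ⟨r, by rw [hr] at hc; linarith⟩ hm₀
      · have h2 : (2 : ℤ) ∣ N := ⟨m - N * r, by rw [hr] at hc; linarith⟩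
        obtain ⟨n, hn⟩ : 2 ∣ N := by exact_mod_cast h2
        refine ⟨n, hn, ?_⟩
        have : m = n + N * r := by
          rw [hr, hn] at hc
          rw [hn]
          push_cast at hc ⊢
          linarith
        rw [this]
        simp
    refine ⟨n, by omega, ⟨(RelIso.symm ⟨Equiv.ofBijective E ⟨hEinj, fun v => ?_⟩, ?_⟩)⟩⟩
    · rcases hcover v with ⟨k, hk⟩ | ⟨k, hk⟩
      · exact ⟨k, by rw [hE, hk]⟩
      · exact ⟨(k + m : ℤ), by rw [hE, ← htr, hk]⟩
    · intro x y
      have hfE : f (E x) = E (x + n) := by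
        obtain ⟨k, rfl⟩ := ZMod.intCast_surjective x
        rw [hE, htr, ← hn, ← Int.cast_add, hE]
      change Γ.Adj (E x) (E y) ↔ (mobiusLadder n).Adj x y
      rw [mobiusLadder_adj (by omega), hEadj, hfE, hEinj.eq_iff, hEinj.eq_iff, hEinj.eq_iff]
  · left
    have hdisj : ∀ x y, f (E x) ≠ E y := fun x y e => by
      obtain ⟨i, rfl⟩ := ZMod.intCast_surjective x
      obtain ⟨j, rfl⟩ := ZMod.intCast_surjective y
      rw [hE, hE] at e
      refine hmeet ⟨-i + j, ?_⟩
      simpa using hw.matching_translate ff haut hf e (-i)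
    have hdisj' : ∀ x y, E y ≠ f (E x) := fun x y => (hdisj x y).symm
    let F : ZMod N × ZMod 2 → V := fun p => if p.2 = 0 then E p.1 else f (E p.1)
    have hF₀ : ∀ x, F (x, 0) = E x := fun x => if_pos rfl
    have hF₁ : ∀ x, F (x, 1) = f (E x) := fun x => if_neg one_ne_zero
    have two : ∀ j : ZMod 2, j = 0 ∨ j = 1 := by decide
    refine ⟨N, hN, ⟨(RelIso.symm ⟨Equiv.ofBijective F ⟨?_, fun v => ?_⟩, ?_⟩)⟩⟩
    · rintro ⟨x, i⟩ ⟨y, j⟩ h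
      rcases two i with rfl | rfl <;> rcases two j with rfl | rfl <;>
        simp only [hF₀, hF₁] at h
      · rw [hEinj h]
      · exact absurd h (hdisj' _ _)
      · exact absurd h (hdisj _ _)
      · rw [hEinj (hinj h)]
    · rcases hcover v with ⟨k, hk⟩ | ⟨k, hk⟩
      · exact ⟨(k, 0), by rw [hF₀, hE, hk]⟩
      · exact ⟨(k, 1), by rw [hF₁, hE, hk]⟩
    · rintro ⟨x, i⟩ ⟨y, j⟩
      have hadj' : ∀ a b, Γ.Adj (f a) (f b) ↔ Γ.Adj a b := fun a b =>
        ⟨fun h => by simpa [ff] using haut _ _ h, haut a b⟩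
      change Γ.Adj (F (x, i)) (F (y, j)) ↔ (circularLadder N).Adj (x, i) (y, j)
      rw [circularLadder_adj hN]
      have h11 : (1 : ZMod 2) + 1 = 0 := by decide
      rcases two i with rfl | rfl <;> rcases two j with rfl | rfl <;>
        simp only [hF₀, hF₁, hadj', SimpleGraph.adj_comm Γ (f _) (E _)] <;>
        simp [hEadj, hdisj, hdisj', hEinj.eq_iff, hinj.eq_iff, h11, sub_eq_add_neg, eq_comm]

section Pair

variable {Γ : SimpleGraph V} {G : Subgroup (Γ ≃g Γ)} {f : V → V}

theorem matching_equivariant (hf1 : ∀ v, Γ.Adj v (f v))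
    (hf2 : ∀ v, ∀ g ∈ G, g v = v → g (f v) = f v)
    (hf3 : ∀ v u, Γ.Adj v u → (∀ g ∈ G, g v = v → g u = u) → u = f v)
    {g : Γ ≃g Γ} (hg : g ∈ G) (v : V) : g (f v) = f (g v) := by
  refine hf3 _ _ (g.map_adj_iff.2 (hf1 v)) fun h hh hv => ?_
  have := hf2 v (g⁻¹ * h * g) (G.mul_mem (G.mul_mem (G.inv_mem hg) hh) hg) (by
    change g.symm (h (g v)) = v
    rw [hv]
    exact g.symm_apply_apply v)
  change g.symm (h (g (f v))) = f v at this
  exact g.symm.injective (this.trans (g.symm_apply_apply _).symm)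

theorem matching_involutive [Finite V] (htrans : ∀ u w : V, ∃ g ∈ G, g u = w)
    (hf1 : ∀ v, Γ.Adj v (f v))
    (hf3 : ∀ v u, Γ.Adj v u → (∀ g ∈ G, g v = v → g u = u) → u = f v)
    (heq : ∀ g ∈ G, ∀ v, g (f v) = f (g v)) (v : V) : f (f v) = v := by
  have hsurj : Function.Surjective f := fun u => by
    obtain ⟨g, hg, e⟩ := htrans (f v) u
    exact ⟨g v, by rw [← heq g hg, e]⟩
  have hinj := Finite.injective_iff_surjective.2 hsurj
  exact (hf3 (f v) v (hf1 v).symm fun g hg h => hinj (by rw [← heq g hg, h])).symm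

/-- The group is transitive on the arcs outside the matching. -/
theorem exists_map_arc (htrans : ∀ u w : V, ∃ g ∈ G, g u = w)
    (hf3 : ∀ v u, Γ.Adj v u → (∀ g ∈ G, g v = v → g u = u) → u = f v)
    (heq : ∀ g ∈ G, ∀ v, g (f v) = f (g v))
    (hnb : ∀ v, ∃ a b, a ≠ b ∧ a ≠ f v ∧ b ≠ f v ∧ ∀ u, Γ.Adj v u ↔ u = f v ∨ u = a ∨ u = b)
    {x₀ y₀ x y : V} (h₀ : Γ.Adj x₀ y₀) (hne₀ : y₀ ≠ f x₀) (h : Γ.Adj x y) (hne : y ≠ f x) :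
    ∃ g ∈ G, g x₀ = x ∧ g y₀ = y := by
  obtain ⟨g, hg, rfl⟩ := htrans x₀ x
  have hgy : Γ.Adj (g x₀) (g y₀) := g.map_adj_iff.2 h₀
  have hgne : g y₀ ≠ f (g x₀) := fun e => hne₀ (g.injective (by rw [e, heq g hg]))
  by_cases hy : g y₀ = y
  · exact ⟨g, hg, rfl, hy⟩
  obtain ⟨k, hk, hkx, hky⟩ : ∃ k ∈ G, k (g x₀) = g x₀ ∧ k (g y₀) ≠ g y₀ := by
    by_contra! hcon
    exact hgne (hf3 _ _ hgy hcon)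
  refine ⟨k * g, G.mul_mem hk hg, hkx, ?_⟩
  change k (g y₀) = y
  have hadj : Γ.Adj (g x₀) (k (g y₀)) := by
    have := k.map_adj_iff.2 hgy
    rwa [hkx] at this
  have hkne : k (g y₀) ≠ f (g x₀) := fun e => hgne (k.injective (by rw [e, heq k hk, hkx]))
  obtain ⟨a, b, _, _, _, hu⟩ := hnb (g x₀)
  rw [hu] at hadj hgy h
  grind

end Pair

/-- Let `(Γ,G)` be a degenerate locally-`Z2^[3]` pair: there exist vertices
`u, v` with `{u,u'} ≠ {v,v'}` such that at least two distinct edges of `Γ` have one endpoint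
in `{u,u'}` and the other in `{v,v'}`. Then `Γ` is isomorphic either to a circular ladder
graph `Cay(Z/n × Z/2, {(1,0),(-1,0),(0,1)})` with `n ≥ 3`, or to a Möbius ladder graph
`Cay(Z/2n, {1,-1,n})` with `n ≥ 2`. -/
theorem stmt_7 [Fintype V] (Γ : SimpleGraph V) (hconn : Γ.Connected)
    (hcubic : ∀ v : V, (Γ.neighborSet v).ncard = 3)
    (G : Subgroup (Γ ≃g Γ))
    (htrans : ∀ u w : V, ∃ g ∈ G, g u = w)
    (horb : ∀ v : V, (nbhdOrbits Γ G v).ncard = 2)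
    (f : V → V)
    (hf1 : ∀ v : V, Γ.Adj v (f v))
    (hf2 : ∀ v : V, ∀ g ∈ G, g v = v → g (f v) = f v)
    (hf3 : ∀ v u : V, Γ.Adj v u → (∀ g ∈ G, g v = v → g u = u) → u = f v)
    (hdeg : ∃ u v : V, ({u, f u} : Set V) ≠ {v, f v} ∧
      ∃ a₁ b₁ a₂ b₂ : V, a₁ ∈ ({u, f u} : Set V) ∧ b₁ ∈ ({v, f v} : Set V) ∧
        a₂ ∈ ({u, f u} : Set V) ∧ b₂ ∈ ({v, f v} : Set V) ∧
        Γ.Adj a₁ b₁ ∧ Γ.Adj a₂ b₂ ∧ s(a₁, b₁) ≠ s(a₂, b₂)) :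
    (∃ n : ℕ, 3 ≤ n ∧ Nonempty (Γ ≃g circularLadder n)) ∨
    (∃ n : ℕ, 2 ≤ n ∧ Nonempty (Γ ≃g mobiusLadder n)) := by
  have hnb : ∀ v, ∃ a b, a ≠ b ∧ a ≠ f v ∧ b ≠ f v ∧
      ∀ u, Γ.Adj v u ↔ u = f v ∨ u = a ∨ u = b := fun v => by
    obtain ⟨x, y, z, hxy, hxz, hyz, hs⟩ := Set.ncard_eq_three.1 (hcubic v)
    have hu : ∀ u, Γ.Adj v u ↔ u = x ∨ u = y ∨ u = z := fun u => by
      rw [← SimpleGraph.mem_neighborSet, hs]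
      simp
    rcases (hu _).1 (hf1 v) with e | e | e
    · exact ⟨y, z, by grind⟩
    · exact ⟨x, z, by grind⟩
    · exact ⟨x, y, by grind⟩
  have heq : ∀ g ∈ G, ∀ v, g (f v) = f (g v) := fun g hg =>
    matching_equivariant hf1 hf2 hf3 hg
  have ff : ∀ v, f (f v) = v := matching_involutive htrans hf1 hf3 heq
  have arc := @exists_map_arc V Γ G f htrans hf3 heq hnb
  have spread : ∀ {x₀ y₀}, Γ.Adj x₀ y₀ → y₀ ≠ f x₀ → Γ.Adj (f x₀) (f y₀) →
      ∀ x y, Γ.Adj x y → y ≠ f x → Γ.Adj (f x) (f y) := by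
    intro x₀ y₀ h₀ hne₀ h x y hxy hne
    obtain ⟨g, hg, rfl, rfl⟩ := arc h₀ hne₀ hxy hne
    rw [← heq g hg, ← heq g hg]
    exact g.map_adj_iff.2 h
  have spread_triangle : ∀ {x₀ y₀}, Γ.Adj x₀ y₀ → y₀ ≠ f x₀ → Γ.Adj x₀ (f y₀) →
      ∀ x y, Γ.Adj x y → y ≠ f x → Γ.Adj (f x) (f y) := by
    intro x₀ y₀ h₀ hne₀ h
    have tri : ∀ x y, Γ.Adj x y → y ≠ f x → Γ.Adj x (f y) := by
      intro x y hxy hne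
      obtain ⟨g, hg, rfl, rfl⟩ := arc h₀ hne₀ hxy hne
      rw [← heq g hg]
      exact g.map_adj_iff.2 h
    have h₁ : Γ.Adj (f x₀) y₀ := (tri y₀ x₀ h₀.symm (fun e => hne₀ (by rw [e, ff]))).symm
    exact spread h₀ hne₀ (tri _ _ h₁ (by rw [ff]; exact h₀.ne'))
  have aut' : ∀ x y, Γ.Adj x y → y ≠ f x → Γ.Adj (f x) (f y) := by
    obtain ⟨u, v, huv, a₁, b₁, a₂, b₂, ha₁, hb₁, ha₂, hb₂, h₁, h₂, hne⟩ := hdeg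
    have pair : ∀ {t a}, a ∈ ({t, f t} : Set V) → ({t, f t} : Set V) = {a, f a} := by
      rintro t a (rfl | rfl)
      · rfl
      · rw [ff, Set.pair_comm]
    rw [pair ha₁] at ha₂ huv
    rw [pair hb₁] at hb₂ huv
    have hb : b₁ ≠ f a₁ := fun e => huv (by rw [e, ff, Set.pair_comm])
    rcases ha₂ with rfl | rfl <;> rcases hb₂ with rfl | rfl
    · exact absurd rfl hne
    · exact spread_triangle h₁ hb h₂
    · exact spread_triangle h₁.symm (fun e => hb (by rw [e, ff])) h₂.symm
    · exact spread h₁ hb h₂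
  refine ladder_of_matching_automorphism hconn ff hf1 (fun x y hxy => ?_) hnb
  by_cases hne : y = f x
  · rw [hne, ff]
    exact (hf1 x).symm
  · exact aut' x y hxy hne
end

section
/- Let Λ be a finite connected simple 4-regular graph, let G be an arc-transitive group of automorphisms of Λ, and suppose that for every vertex v, the permutation group induced by the stabiliser G_v on the neighbourhood Λ(v) is transitive and every non-identity permutation in it is fixed-point-free of order 2. Then for any fixed vertex v there exist elements x, y, a ∈ G with x² = y² = a² = 1 and xy = yx such that G_v = ⟨x,y⟩, the element a interchanges v with a neighbour of v, and G = ⟨x, y, a⟩; in particular, G is generated by three involutions two of which commute. -/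
variable {W : Type*}

/-- The stabiliser `G_v` of a vertex `v` in a group `G` of automorphisms of `Λ`, as a subgroup
of the automorphism group of `Λ`. -/
def vertexStab (Λ : SimpleGraph W) (G : Subgroup (Λ ≃g Λ)) (v : W) : Subgroup (Λ ≃g Λ) where
  carrier := {g | g ∈ G ∧ g v = v}
  one_mem' := ⟨G.one_mem, rfl⟩
  mul_mem' := @fun a b ha hb => ⟨G.mul_mem ha.1 hb.1, by
    rw [show (a * b) v = a (b v) from rfl, hb.2, ha.2]⟩
  inv_mem' := fun ha => ⟨G.inv_mem ha.1, by conv_lhs => rw [← ha.2]; simp⟩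

/-- A property of vertices that passes to adjacent vertices and holds somewhere on a connected
graph holds everywhere. -/
theorem SimpleGraph.Connected.forall_of_adj {Λ : SimpleGraph W} (hconn : Λ.Connected)
    {P : W → Prop} {v : W} (hv : P v) (hstep : ∀ w w', Λ.Adj w w' → P w → P w') (w : W) :
    P w := by
  obtain ⟨p⟩ := hconn.preconnected v w
  induction p with
  | nil => exact hv
  | cons h _ ih => exact ih (hstep _ _ h hv)

/-- If an element fixing a vertex and one of its neighbours fixes all its neighbours, then in a
connected graph an element fixing an arc is trivial. -/
theorem eq_one_of_fixes_arc {Λ : SimpleGraph W} (hconn : Λ.Connected) {g : Λ ≃g Λ}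
    (hloc : ∀ v u, Λ.Adj v u → g v = v → g u = u → ∀ w, Λ.Adj v w → g w = w)
    {v u : W} (hvu : Λ.Adj v u) (hv : g v = v) (hu : g u = u) : g = 1 := by
  have key := hconn.forall_of_adj (P := fun w => g w = w ∧ ∀ w', Λ.Adj w w' → g w' = w')
    ⟨hv, hloc v u hvu hv hu⟩
    (fun w w' h hw => ⟨hw.2 w' h, hloc w' w h.symm (hw.2 w' h) hw.1⟩)
  exact RelIso.ext fun w => (key w).1

/-- Suppose that the stabiliser of `v` in `G` can move `u` to every neighbour of `v`. If a subgroup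
`H` of `G` contains this stabiliser and an element moving `v` to `u`, then `H` contains `G`. -/
theorem le_of_vertexStab_le {Λ : SimpleGraph W} (hconn : Λ.Connected)
    {G H : Subgroup (Λ ≃g Λ)} (hHG : H ≤ G) {v u : W}
    (htrans : ∀ w, Λ.Adj v w → ∃ g ∈ G, g v = v ∧ g u = w)
    (hstab : vertexStab Λ G v ≤ H) {a : Λ ≃g Λ} (ha : a ∈ H) (hav : a v = u) : G ≤ H := by
  have orbit : ∀ w, ∃ h ∈ H, h v = w := by
    refine hconn.forall_of_adj (v := v) ⟨1, H.one_mem, rfl⟩ ?_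
    rintro w w' hww ⟨h, hh, rfl⟩
    obtain ⟨k, hk, hkv, hku⟩ := htrans (h.symm w') (by
      rw [← h.map_adj_iff]; simpa using hww)
    refine ⟨h * (k * a), H.mul_mem hh (H.mul_mem (hstab ⟨hk, hkv⟩) ha), ?_⟩
    change h (k (a v)) = w'
    rw [hav, hku, RelIso.apply_symm_apply]
  intro g hg
  obtain ⟨h, hh, hhv⟩ := orbit (g v)
  have : h⁻¹ * g ∈ H := hstab ⟨G.mul_mem (G.inv_mem (hHG hh)) hg, by
    change h.symm (g v) = v
    rw [← hhv, RelIso.symm_apply_apply]⟩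
  simpa using H.mul_mem hh this

/-- Let `Λ` be a finite connected 4-regular simple graph and `G` an
arc-transitive group of automorphisms of `Λ` such that for every vertex `v` the permutation
group induced by `G_v` on `Λ(v)` is transitive with all non-identity elements fixed-point-free
of order 2. Then for any fixed vertex `v` there exist `x, y, a ∈ G` with
`x² = y² = a² = 1` and `xy = yx`, such that `G_v = ⟨x,y⟩`, the element `a` interchanges `v`
with a neighbour of `v`, and `G = ⟨x,y,a⟩`; in particular `G` is generated by three
involutions two of which commute. -/
theorem stmt_19 [Fintype W] (Λ : SimpleGraph W) (hconn : Λ.Connected)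
    (hreg : ∀ w : W, (Λ.neighborSet w).ncard = 4)
    (G : Subgroup (Λ ≃g Λ))
    (harc : ∀ a b a' b' : W, Λ.Adj a b → Λ.Adj a' b' → ∃ g ∈ G, g a = a' ∧ g b = b')
    (hloctrans : ∀ v : W, ∀ u ∈ Λ.neighborSet v, ∀ w ∈ Λ.neighborSet v,
      ∃ g ∈ G, g v = v ∧ g u = w)
    (hlocklein : ∀ v : W, ∀ g ∈ G, g v = v → (∃ u ∈ Λ.neighborSet v, g u ≠ u) →
      (∀ u ∈ Λ.neighborSet v, g u ≠ u) ∧ (∀ u ∈ Λ.neighborSet v, g (g u) = u)) :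
    ∀ v : W, ∃ x y a : Λ ≃g Λ, x ∈ G ∧ y ∈ G ∧ a ∈ G ∧
      x ^ 2 = 1 ∧ y ^ 2 = 1 ∧ a ^ 2 = 1 ∧ x * y = y * x ∧
      vertexStab Λ G v = Subgroup.closure ({x, y} : Set (Λ ≃g Λ)) ∧
      (∃ u : W, Λ.Adj v u ∧ a v = u ∧ a u = v) ∧
      G = Subgroup.closure ({x, y, a} : Set (Λ ≃g Λ)) := by
  intro v
  have hloc : ∀ g ∈ G, ∀ v u, Λ.Adj v u → g v = v → g u = u → ∀ w, Λ.Adj v w → g w = w := by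
    intro g hg v u hvu hv hu w hw
    by_contra hne
    exact (hlocklein v g hg hv ⟨w, hw, hne⟩).1 u hvu hu
  have harc_one : ∀ g ∈ G, ∀ v u, Λ.Adj v u → g v = v → g u = u → g = 1 :=
    fun g hg _ _ hvu hv hu => eq_one_of_fixes_arc hconn (hloc g hg) hvu hv hu
  have hcard : (Λ.neighborSet v).encard = 4 := by
    have hfin : (Λ.neighborSet v).Finite := Set.toFinite _
    rw [← hfin.cast_ncard_eq, hreg v]; rfl
  obtain ⟨u, u₂, u₃, u₄, h12, h13, h14, h23, h24, h34, hN⟩ := Set.encard_eq_four.mp hcard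
  have hadj : ∀ w, Λ.Adj v w ↔ w = u ∨ w = u₂ ∨ w = u₃ ∨ w = u₄ := by
    intro w
    rw [← SimpleGraph.mem_neighborSet, hN]; simp
  have hu : Λ.Adj v u := (hadj u).2 (by simp)
  have htrans : ∀ w, Λ.Adj v w → ∃ g ∈ G, g v = v ∧ g u = w :=
    fun w hw => hloctrans v u hu w hw
  have hsq : ∀ g ∈ G, g v = v → g * g = 1 := by
    intro g hg hgv
    by_cases hgu : g u = u
    · rw [harc_one g hg v u hu hgv hgu, one_mul]
    · refine harc_one _ (G.mul_mem hg hg) v u hu ?_ ?_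
      · change g (g v) = v
        rw [hgv, hgv]
      · exact (hlocklein v g hg hgv ⟨u, hu, hgu⟩).2 u hu
  have hinj : ∀ g ∈ G, ∀ h ∈ G, g v = v → h v = v → g u = h u → g = h := by
    intro g hg h hh hgv hhv hgh
    refine (inv_mul_eq_one.mp (harc_one (h⁻¹ * g) (G.mul_mem (G.inv_mem hh) hg) v u hu ?_ ?_)).symm
    · change h.symm (g v) = v
      rw [hgv, RelIso.symm_apply_eq, hhv]
    · change h.symm (g u) = u
      rw [hgh, RelIso.symm_apply_apply]
  obtain ⟨x, hx, hxv, hxu⟩ := htrans u₂ ((hadj _).2 (by simp))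
  obtain ⟨y, hy, hyv, hyu⟩ := htrans u₃ ((hadj _).2 (by simp))
  obtain ⟨a, ha, hav, hau⟩ := harc v u u v hu hu.symm
  have hxx := hsq x hx hxv
  have hyy := hsq y hy hyv
  have hxy : x * y ∈ G := G.mul_mem hx hy
  have hxyv : (x * y) v = v := by
    change x (y v) = v
    rw [hyv, hxv]
  have hcomm : x * y = y * x := by
    rw [← inv_eq_of_mul_eq_one_left (hsq _ hxy hxyv), mul_inv_rev,
      inv_eq_of_mul_eq_one_left hxx, inv_eq_of_mul_eq_one_left hyy]
  have hxyu : (x * y) u = u₄ := by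
    have hnbr : Λ.Adj v ((x * y) u) := by
      have := (x * y).map_adj_iff.2 hu
      rwa [hxyv] at this
    rcases (hadj _).1 hnbr with h | h | h | h
    · have h1 := harc_one _ hxy v u hu hxyv h
      have : x = y := by
        rw [eq_inv_of_mul_eq_one_left h1, inv_eq_of_mul_eq_one_left hyy]
      exact absurd (by rw [← hxu, ← hyu, this]) h23
    · have h1 : y u = u := x.injective (h.trans hxu.symm)
      exact absurd (h1.symm.trans hyu) h13
    · rw [hcomm] at h
      have h1 : x u = u := y.injective (h.trans hyu.symm)
      exact absurd (h1.symm.trans hxu) h12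
    · exact h
  have hstab : vertexStab Λ G v = Subgroup.closure ({x, y} : Set (Λ ≃g Λ)) := by
    have hxc : x ∈ Subgroup.closure ({x, y} : Set (Λ ≃g Λ)) :=
      Subgroup.subset_closure (by simp)
    have hyc : y ∈ Subgroup.closure ({x, y} : Set (Λ ≃g Λ)) :=
      Subgroup.subset_closure (by simp)
    apply le_antisymm
    · rintro g ⟨hg, hgv⟩
      have hnbr : Λ.Adj v (g u) := by
        have := g.map_adj_iff.2 hu
        rwa [hgv] at this
      rcases (hadj _).1 hnbr with h | h | h | h
      · rw [harc_one g hg v u hu hgv h]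
        exact Subgroup.one_mem _
      · rwa [hinj g hg x hx hgv hxv (h.trans hxu.symm)]
      · rwa [hinj g hg y hy hgv hyv (h.trans hyu.symm)]
      · rw [hinj g hg _ hxy hgv hxyv (h.trans hxyu.symm)]
        exact Subgroup.mul_mem _ hxc hyc
    · rw [Subgroup.closure_le]
      rintro g (rfl | rfl)
      exacts [⟨hx, hxv⟩, ⟨hy, hyv⟩]
  have haa : a * a = 1 := by
    refine harc_one _ (G.mul_mem ha ha) v u hu ?_ ?_
    · change a (a v) = v
      rw [hav, hau]
    · change a (a u) = u
      rw [hau, hav]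
  refine ⟨x, y, a, hx, hy, ha, by rw [sq, hxx], by rw [sq, hyy], by rw [sq, haa], hcomm, hstab,
    ⟨u, hu, hav, hau⟩, ?_⟩
  have hle : Subgroup.closure ({x, y, a} : Set (Λ ≃g Λ)) ≤ G := by
    rw [Subgroup.closure_le]
    rintro g (rfl | rfl | rfl) <;> assumption
  refine le_antisymm (le_of_vertexStab_le hconn hle htrans ?_
    (Subgroup.subset_closure (by simp)) hav) hle
  rw [hstab]
  exact Subgroup.closure_mono (by grind)
end
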